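/- The Dirac measure δ₀ is the initial trace of the Barenblatt function 𝒰: for every continuous bounded function γ : ℝ → ℝ, ∫_ℝ γ(x) 𝒰(t,x) dx → γ(0) as t → 0⁺. -/

import Mathlib

open MeasureTheory Real Set

/-- The constant k̃ = (1-m)/(2(m+1)m). -/
noncomputable def ktilde (m : ℝ) : ℝ := (1 - m) / (2 * (m + 1) * m)

/-- The constant I = ∫_{-π/2}^{π/2} (cos x)^{2m/(1-m)} dx. -/
noncomputable def Iconst (m : ℝ) : ℝ := ∫ x in (-(π/2))..(π/2), Real.cos x ^ (2*m/(1-m))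

/-- The constant D = (I/√k̃)^{2(1-m)/(m+1)}. -/
noncomputable def Dconst (m : ℝ) : ℝ := (Iconst m / Real.sqrt (ktilde m)) ^ (2*(1-m)/(m+1))

/-- The Barenblatt function 𝒰(t,x) = t^{-α}(D + k̃ x² t^{-2α})^{-1/(1-m)}, α = 1/(m+1). -/
noncomputable def barenblatt (m t x : ℝ) : ℝ :=
  t ^ (-(1/(m+1))) * (Dconst m + ktilde m * x^2 * t ^ (-(2*(1/(m+1))))) ^ (-(1/(1-m)))

/-- The substitution `x = tan θ` turns `∫ (1 + x²)^{-p}` into an integral of a power of `cos`. -/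
theorem integral_one_add_sq_rpow_neg (p : ℝ) :
    ∫ x : ℝ, (1 + x ^ 2) ^ (-p) = ∫ θ in (-(π / 2))..(π / 2), cos θ ^ (2 * p - 2) := by
  have himage : tan '' Ioo (-(π / 2)) (π / 2) = univ := image_tan_Ioo
  have hderiv : ∀ θ ∈ Ioo (-(π / 2)) (π / 2),
      HasDerivWithinAt tan (1 / cos θ ^ 2) (Ioo (-(π / 2)) (π / 2)) θ := fun θ hθ =>
    (hasDerivAt_tan_of_mem_Ioo hθ).hasDerivWithinAt
  rw [← setIntegral_univ, ← himage,
    integral_image_eq_integral_abs_deriv_smul measurableSet_Ioo hderiv injOn_tan,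
    intervalIntegral.integral_of_le (by linarith [pi_pos]), integral_Ioc_eq_integral_Ioo]
  refine setIntegral_congr_fun measurableSet_Ioo fun θ hθ => ?_
  have hcos : 0 < cos θ := cos_pos_of_mem_Ioo hθ
  have htan : 1 + tan θ ^ 2 = cos θ ^ (-2 : ℝ) := by
    rw [rpow_neg hcos.le, rpow_two, ← inv_one_add_tan_sq hcos.ne', inv_inv]
  have habs : |1 / cos θ ^ 2| = cos θ ^ (-2 : ℝ) := by
    rw [abs_of_pos (by positivity), rpow_neg hcos.le, rpow_two, one_div]
  simp only [smul_eq_mul]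
  rw [habs, htan, ← rpow_mul hcos.le, ← rpow_add hcos]
  congr 1
  ring

theorem integrable_one_add_sq_rpow_neg {p : ℝ} (hp : 1 / 2 < p) :
    Integrable fun x : ℝ => (1 + x ^ 2) ^ (-p) := by
  have h := integrable_rpow_neg_one_add_norm_sq (E := ℝ) (μ := volume) (r := 2 * p)
    (by rw [Module.finrank_self]; push_cast; linarith)
  refine h.congr (Filter.Eventually.of_forall fun x => ?_)
  simp only [norm_eq_abs, sq_abs]
  congr 1
  ring

theorem add_mul_sq_rpow_neg_comp_mul {D k : ℝ} (hD : 0 < D) (hk : 0 < k) (p y : ℝ) :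
    (D + k * (√(D / k) * y) ^ 2) ^ (-p) = D ^ (-p) * (1 + y ^ 2) ^ (-p) := by
  rw [← mul_rpow hD.le (by positivity), mul_pow, sq_sqrt (by positivity)]
  congr 1
  field_simp

theorem integrable_add_mul_sq_rpow_neg {D k p : ℝ} (hD : 0 < D) (hk : 0 < k) (hp : 1 / 2 < p) :
    Integrable fun x : ℝ => (D + k * x ^ 2) ^ (-p) := by
  have hb : √(D / k) ≠ 0 := by positivity
  rw [← integrable_comp_mul_left_iff _ hb]
  simp only [add_mul_sq_rpow_neg_comp_mul hD hk]
  exact (integrable_one_add_sq_rpow_neg hp).const_mul _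

theorem integral_add_mul_sq_rpow_neg {D k : ℝ} (hD : 0 < D) (hk : 0 < k) (p : ℝ) :
    ∫ x : ℝ, (D + k * x ^ 2) ^ (-p) =
      √(D / k) * D ^ (-p) * ∫ x : ℝ, (1 + x ^ 2) ^ (-p) := by
  have hb : 0 < √(D / k) := by positivity
  have h := Measure.integral_comp_mul_left (fun x : ℝ => (D + k * x ^ 2) ^ (-p)) √(D / k)
  simp only [add_mul_sq_rpow_neg_comp_mul hD hk] at h
  rw [integral_const_mul, abs_of_pos (by positivity), smul_eq_mul] at h
  rw [mul_assoc, h, mul_inv_cancel_left₀ hb.ne']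

theorem ktilde_pos {m : ℝ} (hm : m ∈ Ioo (0 : ℝ) 1) : 0 < ktilde m := by
  have h0 := hm.1
  have h1 : 0 < 1 - m := sub_pos.2 hm.2
  unfold ktilde
  positivity

theorem Iconst_pos {m : ℝ} (hm : m ∈ Ioo (0 : ℝ) 1) : 0 < Iconst m := by
  have h0 := hm.1
  have h1 : 0 < 1 - m := sub_pos.2 hm.2
  refine intervalIntegral.intervalIntegral_pos_of_pos_on ?_
    (fun x hx => rpow_pos_of_pos (cos_pos_of_mem_Ioo hx) _) (by linarith [pi_pos])
  exact (continuous_cos.rpow_const fun _ => Or.inr (by positivity)).intervalIntegrable _ _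

theorem Dconst_pos {m : ℝ} (hm : m ∈ Ioo (0 : ℝ) 1) : 0 < Dconst m :=
  rpow_pos_of_pos (div_pos (Iconst_pos hm) (sqrt_pos.2 (ktilde_pos hm))) _

/-- The constant `D` normalizes the Barenblatt profile to have unit mass. -/
theorem integral_barenblatt_profile {m : ℝ} (hm : m ∈ Ioo (0 : ℝ) 1) :
    ∫ x : ℝ, (Dconst m + ktilde m * x ^ 2) ^ (-(1 / (1 - m))) = 1 := by
  have h0 := hm.1
  have h1 : 0 < 1 - m := sub_pos.2 hm.2
  have hk := ktilde_pos hm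
  have hD := Dconst_pos hm
  have hI := Iconst_pos hm
  have hexp : 2 * (1 / (1 - m)) - 2 = 2 * m / (1 - m) := by
    field_simp
    ring
  rw [integral_add_mul_sq_rpow_neg hD hk, integral_one_add_sq_rpow_neg, hexp]
  change _ * Iconst m = 1
  have hDpow : √(Dconst m) * Dconst m ^ (-(1 / (1 - m))) = (Iconst m / √(ktilde m))⁻¹ := by
    rw [sqrt_eq_rpow, ← rpow_add hD, Dconst, ← rpow_mul (by positivity), ← rpow_neg_one]
    congr 1
    field_simp
    ring
  rw [sqrt_div hD.le, div_mul_eq_mul_div, hDpow]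
  have hs : 0 < √(ktilde m) := sqrt_pos.2 hk
  field_simp

/-- Self-similarity of the Barenblatt function. -/
theorem mul_barenblatt_comp_mul {t : ℝ} (ht : 0 < t) (m y : ℝ) :
    t ^ (1 / (m + 1)) * barenblatt m t (t ^ (1 / (m + 1)) * y) =
      (Dconst m + ktilde m * y ^ 2) ^ (-(1 / (1 - m))) := by
  have hs : 0 < t ^ (1 / (m + 1)) := rpow_pos_of_pos ht _
  have hsq : t ^ (-(2 * (1 / (m + 1)))) = ((t ^ (1 / (m + 1))) ^ 2)⁻¹ := by
    rw [rpow_neg ht.le, mul_comm, rpow_mul ht.le, rpow_two]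
  rw [barenblatt, hsq, rpow_neg ht.le, mul_inv_cancel_left₀ hs.ne']
  congr 1
  field_simp

theorem integral_mul_barenblatt {t : ℝ} (ht : 0 < t) (m : ℝ) (γ : ℝ → ℝ) :
    ∫ x : ℝ, γ x * barenblatt m t x =
      ∫ y : ℝ, γ (t ^ (1 / (m + 1)) * y) *
        (Dconst m + ktilde m * y ^ 2) ^ (-(1 / (1 - m))) := by
  have hs : 0 < t ^ (1 / (m + 1)) := rpow_pos_of_pos ht _
  have h := Measure.integral_comp_mul_left (fun x => γ x * barenblatt m t x) (t ^ (1 / (m + 1)))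
  rw [abs_of_pos (inv_pos.2 hs), smul_eq_mul, eq_inv_mul_iff_mul_eq₀ hs.ne',
    ← integral_const_mul] at h
  rw [← h]
  refine integral_congr_ae (Filter.Eventually.of_forall fun y => ?_)
  simp only [← mul_barenblatt_comp_mul ht]
  ring

/-- δ₀ is the initial trace of 𝒰: for every bounded continuous γ,
∫ γ(x) 𝒰(t,x) dx → γ(0) as t → 0⁺. -/
theorem barenblatt_initial_trace_dirac
    (m : ℝ) (hm : m ∈ Set.Ioo (0:ℝ) 1) (γ : BoundedContinuousFunction ℝ ℝ) :
    Filter.Tendsto (fun t => ∫ x : ℝ, γ x * barenblatt m t x)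
      (nhdsWithin 0 (Set.Ioi 0)) (nhds (γ 0)) := by
  have h0 := hm.1
  have h1 : 0 < 1 - m := sub_pos.2 hm.2
  have hint := integrable_add_mul_sq_rpow_neg (p := 1 / (1 - m)) (Dconst_pos hm) (ktilde_pos hm)
    (by rw [div_lt_div_iff₀ two_pos h1]; linarith)
  have hscale : Filter.Tendsto (fun t : ℝ => t ^ (1 / (m + 1)))
      (nhdsWithin 0 (Set.Ioi 0)) (nhds 0) := by
    have h := (continuousAt_rpow_const (0 : ℝ) (1 / (m + 1)) (Or.inr (by positivity))).tendsto
    rw [zero_rpow (by positivity)] at h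
    exact h.mono_left nhdsWithin_le_nhds
  have hlim : ∫ y : ℝ, γ 0 * (Dconst m + ktilde m * y ^ 2) ^ (-(1 / (1 - m))) = γ 0 := by
    rw [integral_const_mul, integral_barenblatt_profile hm, mul_one]
  rw [← hlim]
  refine Filter.Tendsto.congr' (Filter.eventuallyEq_of_mem self_mem_nhdsWithin
    fun t ht => (integral_mul_barenblatt ht m γ).symm) ?_
  refine tendsto_integral_filter_of_dominated_convergence
    (fun y => ‖γ‖ * ‖(Dconst m + ktilde m * y ^ 2) ^ (-(1 / (1 - m)))‖)
    (Filter.Eventually.of_forall fun t => ?_) (Filter.Eventually.of_forall fun t => ?_)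
    (hint.norm.const_mul _) (Filter.Eventually.of_forall fun y => ?_)
  · exact (γ.continuous.comp (continuous_const_mul _)).aestronglyMeasurable.mul
      hint.aestronglyMeasurable
  · refine Filter.Eventually.of_forall fun y => ?_
    rw [norm_mul]
    gcongr
    exact γ.norm_coe_le_norm _
  · refine Filter.Tendsto.mul_const _ ((γ.continuous.tendsto 0).comp ?_)
    simpa using hscale.mul_const y
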